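/- arXiv:math/9903120 — 2 statements merged into one kernel-verified Lean document; each statement's English description precedes it below -/
import Mathlib

section
/- Let K be an algebraically closed field, let α, β, γ ∈ K with β ≠ 0, let A = A(α,β,γ) be the down-up algebra, and let σ be the automorphism of R = K[x,y] with σ(x) = y, σ(y) = α·y + β·x + γ. Then the following are equivalent: (1) every finitely generated left A-module in which every element is annihilated by some power of d and by some power of u is finite-dimensional over K; (2) for every n ≥ 1, σ^n(x) does not lie in the ideal of R generated by x. -/
noncomputable section

/-- The defining relations of the down-up algebra `A(α,β,γ)`:
generator `0` is `d`, generator `1` is `u`. -/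
inductive DownUpRel (K : Type) [Field K] (α β γ : K) :
    FreeAlgebra K (Fin 2) → FreeAlgebra K (Fin 2) → Prop
  | rel1 : DownUpRel K α β γ
      (FreeAlgebra.ι K 0 * FreeAlgebra.ι K 0 * FreeAlgebra.ι K 1)
      (α • (FreeAlgebra.ι K 0 * FreeAlgebra.ι K 1 * FreeAlgebra.ι K 0) +
        β • (FreeAlgebra.ι K 1 * FreeAlgebra.ι K 0 * FreeAlgebra.ι K 0) +
        γ • FreeAlgebra.ι K 0)
  | rel2 : DownUpRel K α β γ
      (FreeAlgebra.ι K 0 * FreeAlgebra.ι K 1 * FreeAlgebra.ι K 1)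
      (α • (FreeAlgebra.ι K 1 * FreeAlgebra.ι K 0 * FreeAlgebra.ι K 1) +
        β • (FreeAlgebra.ι K 1 * FreeAlgebra.ι K 1 * FreeAlgebra.ι K 0) +
        γ • FreeAlgebra.ι K 1)

/-- The down-up algebra `A(α,β,γ)`. -/
abbrev DownUp (K : Type) [Field K] (α β γ : K) := RingQuot (DownUpRel K α β γ)

/-- The generator `d` of the down-up algebra. -/
def DownUp.d (K : Type) [Field K] (α β γ : K) : DownUp K α β γ :=
  RingQuot.mkAlgHom K (DownUpRel K α β γ) (FreeAlgebra.ι K 0)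

/-- The generator `u` of the down-up algebra. -/
def DownUp.u (K : Type) [Field K] (α β γ : K) : DownUp K α β γ :=
  RingQuot.mkAlgHom K (DownUpRel K α β γ) (FreeAlgebra.ι K 1)

open MvPolynomial in
/-- The endomorphism `σ` of `R = K[x,y]` with `σ(x) = y`, `σ(y) = α·y + β·x + γ`
(here `x = X 0`, `y = X 1`); it is an automorphism when `β ≠ 0`. -/
def duSigma (K : Type) [Field K] (α β γ : K) :
    MvPolynomial (Fin 2) K →ₐ[K] MvPolynomial (Fin 2) K :=
  MvPolynomial.aeval ![X 1, C α * X 1 + C β * X 0 + C γ]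


section PlaneIdeals

open MvPolynomial

/-- An ideal of finite codimension in a finitely generated commutative algebra over a field is
detected on the quotients by the primes containing it. -/
theorem Ideal.finite_quotient_of_forall_isPrime {K R : Type*} [Field K] [CommRing R] [Algebra K R]
    [Algebra.FiniteType K R] (I : Ideal R)
    (h : ∀ P : Ideal R, P.IsPrime → I ≤ P → Module.Finite K (R ⧸ P)) :
    Module.Finite K (R ⧸ I) := by
  have : IsNoetherianRing R := Algebra.FiniteType.isNoetherianRing K R
  have : Ring.KrullDimLE 0 (R ⧸ I) := Ring.KrullDimLE.mk₀ fun Q hQ ↦ by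
    have hle : I ≤ Q.comap (Ideal.Quotient.mk I) := fun x hx ↦ by
      rw [Ideal.mem_comap, Ideal.Quotient.eq_zero_iff_mem.mpr hx]
      exact Q.zero_mem
    have hfin := h _ (hQ.comap (Ideal.Quotient.mk I)) hle
    have hmax : (Q.comap (Ideal.Quotient.mk I)).IsMaximal :=
      Ideal.Quotient.maximal_of_isField _
        (isField_of_isIntegral_of_isField' (R := K) (Field.toIsField K))
    rw [← Ideal.map_comap_of_surjective _ Ideal.Quotient.mk_surjective Q]
    exact (Ideal.map_eq_top_or_isMaximal_of_surjective _ Ideal.Quotient.mk_surjective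
      hmax).resolve_left (by
        rw [Ideal.map_comap_of_surjective _ Ideal.Quotient.mk_surjective Q]
        exact hQ.ne_top)
  exact (Module.finite_iff_isArtinianRing K (R ⧸ I)).mpr
    IsNoetherianRing.isArtinianRing_of_krullDimLE_zero

/-- Finite codimension of ideals passes along surjective algebra maps. -/
theorem Ideal.finite_quotient_of_le_comap {K R S : Type*} [Field K] [CommRing R] [Algebra K R]
    [CommRing S] [Algebra K S] {I : Ideal R} {J : Ideal S} (f : R →ₐ[K] S)
    (hf : Function.Surjective f) (hIJ : I ≤ J.comap f) (hI : Module.Finite K (R ⧸ I)) :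
    Module.Finite K (S ⧸ J) :=
  Module.Finite.of_surjective (Ideal.quotientMapₐ J f hIJ).toLinearMap
    (Ideal.quotientMap_surjective (H := hIJ) hf)

/-- Restriction of polynomials in two variables to the line `x = 0`. -/
def restrictLine (K : Type*) [Field K] : MvPolynomial (Fin 2) K →ₐ[K] Polynomial K :=
  aeval ![0, Polynomial.X]

theorem restrictLine_eq_zero_of_mem {K : Type*} [Field K] {h : MvPolynomial (Fin 2) K}
    (hh : h ∈ Ideal.span ({X 0} : Set (MvPolynomial (Fin 2) K))) : restrictLine K h = 0 := by
  obtain ⟨q, rfl⟩ := Ideal.mem_span_singleton'.mp hh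
  simp [restrictLine]

/-- Modulo an ideal containing `x`, a polynomial agrees with its restriction to `x = 0`. -/
theorem mk_eq_aeval_restrictLine {K : Type*} [Field K] {I : Ideal (MvPolynomial (Fin 2) K)}
    (hI : X 0 ∈ I) (h : MvPolynomial (Fin 2) K) :
    Ideal.Quotient.mkₐ K I h =
      Polynomial.aeval (Ideal.Quotient.mkₐ K I (X 1)) (restrictLine K h) := by
  have key : Ideal.Quotient.mkₐ K I =
      (Polynomial.aeval (Ideal.Quotient.mkₐ K I (X 1))).comp (restrictLine K) := by
    ext i
    fin_cases i
    · simpa [restrictLine] using Ideal.Quotient.eq_zero_iff_mem.mpr hI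
    · simp [restrictLine]
  exact DFunLike.congr_fun key h

theorem mem_span_of_restrictLine_eq_zero {K : Type*} [Field K] {h : MvPolynomial (Fin 2) K}
    (hh : restrictLine K h = 0) : h ∈ Ideal.span ({X 0} : Set (MvPolynomial (Fin 2) K)) := by
  have := mk_eq_aeval_restrictLine (Ideal.mem_span_singleton_self (X 0)) h
  rw [hh, map_zero] at this
  exact Ideal.Quotient.eq_zero_iff_mem.mp this

/-- An ideal containing `x` and a polynomial outside `(x)` has finite codimension. -/
theorem finite_quotient_of_X_mem {K : Type*} [Field K] {I : Ideal (MvPolynomial (Fin 2) K)}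
    {h : MvPolynomial (Fin 2) K} (hx : X 0 ∈ I) (hI : h ∈ I)
    (hh : h ∉ Ideal.span ({X 0} : Set (MvPolynomial (Fin 2) K))) :
    Module.Finite K (MvPolynomial (Fin 2) K ⧸ I) := by
  have hq : restrictLine K h ≠ 0 := fun h0 ↦ hh (mem_span_of_restrictLine_eq_zero h0)
  have hfin : Module.Finite K (Polynomial K ⧸ Ideal.span {restrictLine K h}) :=
    (AdjoinRoot.powerBasis hq).finite
  let g : Polynomial K →ₐ[K] MvPolynomial (Fin 2) K ⧸ I :=
    Polynomial.aeval (Ideal.Quotient.mkₐ K I (X 1))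
  have hg : Function.Surjective g := fun z ↦ by
    obtain ⟨p, rfl⟩ := Ideal.Quotient.mk_surjective z
    exact ⟨restrictLine K p, (mk_eq_aeval_restrictLine hx p).symm⟩
  have hker : ∀ a ∈ Ideal.span {restrictLine K h}, g a = 0 := fun a ha ↦ by
    obtain ⟨b, rfl⟩ := Ideal.mem_span_singleton'.mp ha
    rw [map_mul, ← mk_eq_aeval_restrictLine hx h]
    exact mul_eq_zero_of_right _ (Ideal.Quotient.eq_zero_iff_mem.mpr hI)
  exact Module.Finite.of_surjective (Ideal.Quotient.liftₐ _ g hker).toLinearMap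
    (Ideal.Quotient.lift_surjective_of_surjective _ hker hg)

end PlaneIdeals

section Sigma

open MvPolynomial

variable {K : Type} [Field K] {α β γ : K}

/-- The inverse of `duSigma` when `β ≠ 0`. -/
def duSigmaInv (K : Type) [Field K] (α β γ : K) :
    MvPolynomial (Fin 2) K →ₐ[K] MvPolynomial (Fin 2) K :=
  aeval ![C β⁻¹ * (X 1 - C α * X 0 - C γ), X 0]

theorem duSigma_mul_duSigmaInv (hβ : β ≠ 0) : duSigma K α β γ * duSigmaInv K α β γ = 1 := by
  have hC : (C β⁻¹ * C β : MvPolynomial (Fin 2) K) = 1 := by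
    rw [← C_mul, inv_mul_cancel₀ hβ, C_1]
  apply MvPolynomial.algHom_ext
  intro i
  fin_cases i
  · simp only [duSigma, duSigmaInv, AlgHom.mul_apply, Fin.zero_eta, aeval_X, Matrix.cons_val_zero,
      map_mul, map_sub, algHom_C, algebraMap_eq, Matrix.cons_val_one, AlgHom.one_apply]
    linear_combination X 0 * hC
  · simp [duSigma, duSigmaInv]

theorem duSigmaInv_mul_duSigma (hβ : β ≠ 0) : duSigmaInv K α β γ * duSigma K α β γ = 1 := by
  have hC : (C β * C β⁻¹ : MvPolynomial (Fin 2) K) = 1 := by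
    rw [← C_mul, mul_inv_cancel₀ hβ, C_1]
  apply MvPolynomial.algHom_ext
  intro i
  fin_cases i
  · simp [duSigma, duSigmaInv]
  · simp only [duSigma, duSigmaInv, AlgHom.mul_apply, Fin.mk_one, aeval_X, Matrix.cons_val_zero,
      map_mul, map_add, algHom_C, algebraMap_eq, Matrix.cons_val_one, AlgHom.one_apply]
    linear_combination (X 1 - C α * X 0 - C γ) * hC

theorem duSigmaInv_pow_duSigma_pow (hβ : β ≠ 0) (n : ℕ) (p : MvPolynomial (Fin 2) K) :
    (duSigmaInv K α β γ ^ n) ((duSigma K α β γ ^ n) p) = p := by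
  have hc : Commute (duSigmaInv K α β γ) (duSigma K α β γ) :=
    (duSigmaInv_mul_duSigma hβ).trans (duSigma_mul_duSigmaInv hβ).symm
  rw [← AlgHom.mul_apply, ← hc.mul_pow, duSigmaInv_mul_duSigma hβ, one_pow, AlgHom.one_apply]

theorem duSigma_pow_duSigmaInv_pow (hβ : β ≠ 0) (n : ℕ) (p : MvPolynomial (Fin 2) K) :
    (duSigma K α β γ ^ n) ((duSigmaInv K α β γ ^ n) p) = p := by
  have hc : Commute (duSigma K α β γ) (duSigmaInv K α β γ) :=
    (duSigma_mul_duSigmaInv hβ).trans (duSigmaInv_mul_duSigma hβ).symm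
  rw [← AlgHom.mul_apply, ← hc.mul_pow, duSigma_mul_duSigmaInv hβ, one_pow, AlgHom.one_apply]

/-- If no `σ^n(x)` with `n ≥ 1` lies in `(x)`, an ideal containing a product of the
`σ^{-i}(x)`, `i ≥ 0`, and a product of the `σ^{j}(x)`, `j ≥ 1`, has finite codimension. -/
theorem finite_quotient_of_prod_mem (hβ : β ≠ 0)
    (hσ : ∀ n : ℕ, 1 ≤ n →
      (duSigma K α β γ ^ n) (X 0) ∉ Ideal.span ({X 0} : Set (MvPolynomial (Fin 2) K)))
    {I : Ideal (MvPolynomial (Fin 2) K)} {r s : ℕ}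
    (hr : ∏ i ∈ Finset.range r, (duSigmaInv K α β γ ^ i) (X 0) ∈ I)
    (hs : ∏ j ∈ Finset.range s, (duSigma K α β γ ^ (j + 1)) (X 0) ∈ I) :
    Module.Finite K (MvPolynomial (Fin 2) K ⧸ I) := by
  refine Ideal.finite_quotient_of_forall_isPrime I fun P hP hIP ↦ ?_
  obtain ⟨i, -, hi⟩ := hP.prod_mem_iff.mp (hIP hr)
  obtain ⟨j, -, hj⟩ := hP.prod_mem_iff.mp (hIP hs)
  refine Ideal.finite_quotient_of_le_comap (I := P.comap (duSigmaInv K α β γ ^ i))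
    (duSigmaInv K α β γ ^ i) (fun p ↦ ⟨_, duSigmaInv_pow_duSigma_pow hβ i p⟩) le_rfl
    (finite_quotient_of_X_mem (h := (duSigma K α β γ ^ (i + (j + 1))) (X 0)) hi ?_
      (hσ _ (by omega)))
  rw [Ideal.mem_comap, pow_add, AlgHom.mul_apply, duSigmaInv_pow_duSigma_pow hβ]
  exact hj

end Sigma

section Relations

variable {K : Type} [Field K] {α β γ : K}

theorem DownUp.d_mul_d_mul_u :
    d K α β γ * d K α β γ * u K α β γ = α • (d K α β γ * u K α β γ * d K α β γ) +
      β • (u K α β γ * d K α β γ * d K α β γ) + γ • d K α β γ := by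
  simpa [d, u] using RingQuot.mkAlgHom_rel K (DownUpRel.rel1 (K := K) (α := α) (β := β) (γ := γ))

theorem DownUp.d_mul_u_mul_u :
    d K α β γ * u K α β γ * u K α β γ = α • (u K α β γ * d K α β γ * u K α β γ) +
      β • (u K α β γ * u K α β γ * d K α β γ) + γ • u K α β γ := by
  simpa [d, u] using RingQuot.mkAlgHom_rel K (DownUpRel.rel2 (K := K) (α := α) (β := β) (γ := γ))

/-- `d` and `u` generate the down-up algebra. -/
theorem DownUp.adjoin_d_u : Algebra.adjoin K {d K α β γ, u K α β γ} = ⊤ := by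
  have h := congrArg (Subalgebra.map (RingQuot.mkAlgHom K (DownUpRel K α β γ)))
    (FreeAlgebra.adjoin_range_ι (R := K) (X := Fin 2))
  rw [AlgHom.map_adjoin, Algebra.map_top,
    (AlgHom.range_eq_top _).mpr (RingQuot.mkAlgHom_surjective K _)] at h
  rw [← h]
  congr 1
  ext a
  simp [d, u, eq_comm]

open scoped IsMulCommutative in
/-- `ud` and `du` commute, so they define a map from the polynomial ring to the down-up algebra. -/
theorem DownUp.exists_algHom : ∃ φ : MvPolynomial (Fin 2) K →ₐ[K] DownUp K α β γ,
    φ (MvPolynomial.X 0) = u K α β γ * d K α β γ ∧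
    φ (MvPolynomial.X 1) = d K α β γ * u K α β γ := by
  have hcomm : (u K α β γ * d K α β γ) * (d K α β γ * u K α β γ) =
      (d K α β γ * u K α β γ) * (u K α β γ * d K α β γ) := by
    have h1 := congrArg (u K α β γ * ·) (d_mul_d_mul_u (K := K) (α := α) (β := β) (γ := γ))
    have h2 := congrArg (· * d K α β γ) (d_mul_u_mul_u (K := K) (α := α) (β := β) (γ := γ))
    simp only [mul_add, add_mul, mul_smul_comm, smul_mul_assoc, ← mul_assoc] at h1 h2 ⊢
    rw [h1, h2]
  have : IsMulCommutative
      (Algebra.adjoin K {u K α β γ * d K α β γ, d K α β γ * u K α β γ}) :=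
    Algebra.isMulCommutative_adjoin K (by
      rintro a (rfl | rfl) b (rfl | rfl)
      exacts [rfl, hcomm, hcomm.symm, rfl])
  let x : Algebra.adjoin K {u K α β γ * d K α β γ, d K α β γ * u K α β γ} :=
    ⟨_, Algebra.subset_adjoin (Set.mem_insert _ _)⟩
  let y : Algebra.adjoin K {u K α β γ * d K α β γ, d K α β γ * u K α β γ} :=
    ⟨_, Algebra.subset_adjoin (Set.mem_insert_of_mem _ rfl)⟩
  exact ⟨(Subalgebra.val _).comp (MvPolynomial.aeval ![x, y]), by simp [x], by simp [y]⟩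

/-- The map from the polynomial ring to the down-up algebra with `x ↦ ud` and `y ↦ du`. -/
def DownUp.ofPoly (K : Type) [Field K] (α β γ : K) :
    MvPolynomial (Fin 2) K →ₐ[K] DownUp K α β γ :=
  exists_algHom.choose

@[simp]
theorem DownUp.ofPoly_X_zero :
    ofPoly K α β γ (MvPolynomial.X 0) = u K α β γ * d K α β γ :=
  exists_algHom.choose_spec.1

@[simp]
theorem DownUp.ofPoly_X_one :
    ofPoly K α β γ (MvPolynomial.X 1) = d K α β γ * u K α β γ :=
  exists_algHom.choose_spec.2

theorem DownUp.d_mul_ofPoly (p : MvPolynomial (Fin 2) K) :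
    d K α β γ * ofPoly K α β γ p = ofPoly K α β γ (duSigma K α β γ p) * d K α β γ := by
  induction p using MvPolynomial.induction_on with
  | C a => simpa [← MvPolynomial.algebraMap_eq] using (Algebra.commutes a (d K α β γ)).symm
  | add p q hp hq => simp [mul_add, add_mul, hp, hq]
  | mul_X p i hp =>
    rw [map_mul, map_mul, map_mul, ← mul_assoc, hp, mul_assoc, mul_assoc]
    congr 1
    fin_cases i
    · simp [duSigma, mul_assoc]
    · simp [duSigma, ← mul_assoc, d_mul_d_mul_u, add_mul, ← MvPolynomial.algebraMap_eq,
        Algebra.smul_def]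

theorem DownUp.ofPoly_mul_u (p : MvPolynomial (Fin 2) K) :
    ofPoly K α β γ p * u K α β γ = u K α β γ * ofPoly K α β γ (duSigma K α β γ p) := by
  induction p using MvPolynomial.induction_on with
  | C a => simpa [← MvPolynomial.algebraMap_eq] using Algebra.commutes a (u K α β γ)
  | add p q hp hq => simp [mul_add, add_mul, hp, hq]
  | mul_X p i hp =>
    rw [mul_comm, map_mul, map_mul, map_mul, mul_assoc, hp, ← mul_assoc, ← mul_assoc]
    congr 1
    fin_cases i
    · simp [duSigma, mul_assoc]
    · simpa [duSigma, mul_add, ← MvPolynomial.algebraMap_eq, Algebra.algebraMap_eq_smul_one,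
        mul_assoc] using d_mul_u_mul_u (K := K) (α := α) (β := β) (γ := γ)

theorem DownUp.d_pow_mul_ofPoly (n : ℕ) (p : MvPolynomial (Fin 2) K) :
    d K α β γ ^ n * ofPoly K α β γ p =
      ofPoly K α β γ ((duSigma K α β γ ^ n) p) * d K α β γ ^ n := by
  induction n with
  | zero => simp
  | succ n ih =>
    rw [pow_succ', mul_assoc, ih, ← mul_assoc, d_mul_ofPoly, pow_succ', AlgHom.mul_apply, mul_assoc]

theorem DownUp.ofPoly_mul_u_pow (n : ℕ) (p : MvPolynomial (Fin 2) K) :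
    ofPoly K α β γ p * u K α β γ ^ n =
      u K α β γ ^ n * ofPoly K α β γ ((duSigma K α β γ ^ n) p) := by
  induction n with
  | zero => simp
  | succ n ih =>
    rw [pow_succ, ← mul_assoc, ih, mul_assoc, ofPoly_mul_u, pow_succ' (duSigma K α β γ),
      AlgHom.mul_apply, mul_assoc]

theorem DownUp.ofPoly_mul_d_pow (hβ : β ≠ 0) (n : ℕ) (p : MvPolynomial (Fin 2) K) :
    ofPoly K α β γ p * d K α β γ ^ n =
      d K α β γ ^ n * ofPoly K α β γ ((duSigmaInv K α β γ ^ n) p) := by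
  rw [d_pow_mul_ofPoly, duSigma_pow_duSigmaInv_pow hβ]

theorem DownUp.u_pow_mul_d_pow (hβ : β ≠ 0) (n : ℕ) :
    u K α β γ ^ n * d K α β γ ^ n = ofPoly K α β γ
      (∏ i ∈ Finset.range n, (duSigmaInv K α β γ ^ i) (MvPolynomial.X 0)) := by
  induction n with
  | zero => simp
  | succ n ih =>
    rw [Finset.prod_range_succ, map_mul, ← ih, mul_assoc, ← ofPoly_mul_d_pow hβ, ofPoly_X_zero,
      pow_succ, pow_succ']
    simp only [mul_assoc]

theorem DownUp.d_pow_mul_u_pow (n : ℕ) :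
    d K α β γ ^ n * u K α β γ ^ n = ofPoly K α β γ
      (∏ j ∈ Finset.range n, (duSigma K α β γ ^ (j + 1)) (MvPolynomial.X 0)) := by
  induction n with
  | zero => simp
  | succ n ih =>
    have h1 : duSigma K α β γ (MvPolynomial.X 0) = MvPolynomial.X 1 := by simp [duSigma]
    rw [Finset.prod_range_succ, map_mul, ← ih, mul_assoc, pow_succ (duSigma K α β γ),
      AlgHom.mul_apply, h1, ← ofPoly_mul_u_pow, ofPoly_X_one, pow_succ, pow_succ']
    simp only [mul_assoc]

end Relations

section Torsion

variable {K : Type} [Field K] {α β γ : K} {M : Type*} [AddCommGroup M] [Module K M]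
  [Module (DownUp K α β γ) M] [IsScalarTower K (DownUp K α β γ) M]

/-- The orbit map of `m` under the polynomial subalgebra generated by `ud` and `du`. -/
def polyOrbitMap (K : Type) [Field K] (α β γ : K) {M : Type*} [AddCommGroup M] [Module K M]
    [Module (DownUp K α β γ) M] [IsScalarTower K (DownUp K α β γ) M] (m : M) :
    MvPolynomial (Fin 2) K →ₗ[K] M :=
  ((LinearMap.toSpanSingleton (DownUp K α β γ) M m).restrictScalars K).comp
    (DownUp.ofPoly K α β γ).toLinearMap

@[simp]
theorem polyOrbitMap_apply (m : M) (p : MvPolynomial (Fin 2) K) :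
    polyOrbitMap K α β γ m p = DownUp.ofPoly K α β γ p • m :=
  rfl

theorem finiteDimensional_range_polyOrbitMap (hβ : β ≠ 0)
    (hσ : ∀ n : ℕ, 1 ≤ n → (duSigma K α β γ ^ n) (MvPolynomial.X 0) ∉
      Ideal.span ({MvPolynomial.X 0} : Set (MvPolynomial (Fin 2) K)))
    {m : M} {r s : ℕ} (hr : DownUp.d K α β γ ^ r • m = 0) (hs : DownUp.u K α β γ ^ s • m = 0) :
    FiniteDimensional K (polyOrbitMap K α β γ m).range := by
  let I : Ideal (MvPolynomial (Fin 2) K) :=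
    { carrier := {p | DownUp.ofPoly K α β γ p • m = 0}
      add_mem' := fun {p q} hp hq ↦ by
        simp_all [add_smul]
      zero_mem' := by simp
      smul_mem' := fun p q hq ↦ by
        simp_all [mul_smul] }
  have hfin : Module.Finite K (MvPolynomial (Fin 2) K ⧸ I) := by
    refine finite_quotient_of_prod_mem (r := r) (s := s) hβ hσ ?_ ?_
    · change DownUp.ofPoly K α β γ _ • m = 0
      rw [← DownUp.u_pow_mul_d_pow hβ, mul_smul, hr, smul_zero]
    · change DownUp.ofPoly K α β γ _ • m = 0
      rw [← DownUp.d_pow_mul_u_pow, mul_smul, hs, smul_zero]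
  have hker : (polyOrbitMap K α β γ m).ker = I.restrictScalars K := rfl
  have : Module.Finite K (MvPolynomial (Fin 2) K ⧸ (polyOrbitMap K α β γ m).ker) := by
    rw [hker]
    exact hfin
  exact Module.Finite.equiv (polyOrbitMap K α β γ m).quotKerEquivRange

/-- A subspace stable under `d` and `u` is stable under the whole down-up algebra. -/
theorem DownUp.smul_mem_of_stable (N : Submodule K M) (hd : ∀ x ∈ N, d K α β γ • x ∈ N)
    (hu : ∀ x ∈ N, u K α β γ • x ∈ N) (a : DownUp K α β γ) : ∀ x ∈ N, a • x ∈ N := by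
  have ha : a ∈ Algebra.adjoin K {d K α β γ, u K α β γ} := by
    rw [adjoin_d_u]
    trivial
  induction ha using Algebra.adjoin_induction with
  | mem a ha =>
    rcases ha with rfl | rfl
    exacts [hd, hu]
  | algebraMap c =>
    intro x hx
    rw [algebraMap_smul]
    exact N.smul_mem c hx
  | add a b _ _ ha hb =>
    intro x hx
    rw [add_smul]
    exact N.add_mem (ha x hx) (hb x hx)
  | mul a b _ _ ha hb =>
    intro x hx
    rw [mul_smul]
    exact ha _ (hb x hx)

theorem finiteDimensional_span_singleton (hβ : β ≠ 0)
    (hσ : ∀ n : ℕ, 1 ≤ n → (duSigma K α β γ ^ n) (MvPolynomial.X 0) ∉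
      Ideal.span ({MvPolynomial.X 0} : Set (MvPolynomial (Fin 2) K)))
    {m : M} {r s : ℕ} (hr : DownUp.d K α β γ ^ r • m = 0) (hs : DownUp.u K α β γ ^ s • m = 0) :
    FiniteDimensional K (Submodule.span (DownUp K α β γ) {m}) := by
  have hW := finiteDimensional_range_polyOrbitMap hβ hσ hr hs
  let mulBy (a : DownUp K α β γ) : M →ₗ[K] M := Algebra.lsmul K K M a
  let D (n : ℕ) : Submodule K M := (polyOrbitMap K α β γ m).range.map (mulBy (DownUp.d K α β γ ^ n))
  let U (n : ℕ) : Submodule K M := (polyOrbitMap K α β γ m).range.map (mulBy (DownUp.u K α β γ ^ n))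
  have memD (n : ℕ) (p : MvPolynomial (Fin 2) K) :
      DownUp.d K α β γ ^ n • DownUp.ofPoly K α β γ p • m ∈ D n := ⟨_, ⟨p, rfl⟩, rfl⟩
  have memU (n : ℕ) (p : MvPolynomial (Fin 2) K) :
      DownUp.u K α β γ ^ n • DownUp.ofPoly K α β γ p • m ∈ U n := ⟨_, ⟨p, rfl⟩, rfl⟩
  let N : Submodule K M := (⨆ i : Fin r, D i) ⊔ (⨆ j : Fin s, U j)
  have hDN (n : ℕ) (p : MvPolynomial (Fin 2) K) :
      DownUp.d K α β γ ^ n • DownUp.ofPoly K α β γ p • m ∈ N := by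
    rcases lt_or_ge n r with h | h
    · exact Submodule.mem_sup_left (Submodule.mem_iSup_of_mem (⟨n, h⟩ : Fin r) (memD n p))
    · rw [← mul_smul, DownUp.d_pow_mul_ofPoly, mul_smul, ← Nat.sub_add_cancel h,
        pow_add (DownUp.d K α β γ), mul_smul, hr, smul_zero, smul_zero]
      exact N.zero_mem
  have hUN (n : ℕ) (p : MvPolynomial (Fin 2) K) :
      DownUp.u K α β γ ^ n • DownUp.ofPoly K α β γ p • m ∈ N := by
    rcases lt_or_ge n s with h | h
    · exact Submodule.mem_sup_right (Submodule.mem_iSup_of_mem (⟨n, h⟩ : Fin s) (memU n p))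
    · rw [← duSigma_pow_duSigmaInv_pow hβ n p, ← mul_smul, ← DownUp.ofPoly_mul_u_pow, mul_smul,
        ← Nat.sub_add_cancel h, pow_add (DownUp.u K α β γ), mul_smul, hs, smul_zero, smul_zero]
      exact N.zero_mem
  have stable (a : DownUp K α β γ)
      (haD : ∀ n p, a • DownUp.d K α β γ ^ n • DownUp.ofPoly K α β γ p • m ∈ N)
      (haU : ∀ n p, a • DownUp.u K α β γ ^ n • DownUp.ofPoly K α β γ p • m ∈ N) :
      ∀ x ∈ N, a • x ∈ N := by
    have hle : N ≤ N.comap (mulBy a) := by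
      refine sup_le (iSup_le fun i ↦ ?_) (iSup_le fun j ↦ ?_)
      · rintro _ ⟨_, ⟨p, rfl⟩, rfl⟩
        exact haD i p
      · rintro _ ⟨_, ⟨p, rfl⟩, rfl⟩
        exact haU j p
    exact hle
  have hN := DownUp.smul_mem_of_stable (α := α) (β := β) (γ := γ) N
    (stable _
      (fun n p ↦ by
        rw [← mul_smul, ← pow_succ']
        exact hDN (n + 1) p)
      (fun n p ↦ by
        cases n with
        | zero => simpa using hDN 1 p
        | succ n =>
          rw [pow_succ', mul_smul, ← mul_smul, ← mul_smul, ← DownUp.ofPoly_X_one, ← mul_smul,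
            DownUp.ofPoly_mul_u_pow, mul_assoc, ← map_mul, mul_smul]
          exact hUN n _))
    (stable _
      (fun n p ↦ by
        cases n with
        | zero => simpa using hUN 1 p
        | succ n =>
          rw [pow_succ', mul_smul, ← mul_smul, ← mul_smul, ← DownUp.ofPoly_X_zero, ← mul_smul,
            DownUp.ofPoly_mul_d_pow hβ, mul_assoc, ← map_mul, mul_smul]
          exact hDN n _)
      (fun n p ↦ by
        rw [← mul_smul, ← pow_succ']
        exact hUN (n + 1) p))
  have hle : (Submodule.span (DownUp K α β γ) {m}).restrictScalars K ≤ N := fun x hx ↦ by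
    obtain ⟨a, rfl⟩ := Submodule.mem_span_singleton.mp hx
    exact hN a m (by simpa using hDN 0 1)
  exact Submodule.finiteDimensional_of_le hle

theorem finiteDimensional_of_torsion (hβ : β ≠ 0)
    (hσ : ∀ n : ℕ, 1 ≤ n → (duSigma K α β γ ^ n) (MvPolynomial.X 0) ∉
      Ideal.span ({MvPolynomial.X 0} : Set (MvPolynomial (Fin 2) K)))
    [Module.Finite (DownUp K α β γ) M]
    (htors : ∀ m : M, (∃ r : ℕ, DownUp.d K α β γ ^ r • m = 0) ∧
      (∃ s : ℕ, DownUp.u K α β γ ^ s • m = 0)) :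
    FiniteDimensional K M := by
  have h : FiniteDimensional K (⊤ : Submodule (DownUp K α β γ) M) := by
    refine Submodule.fg_induction
      (motive := fun (N : Submodule (DownUp K α β γ) M) _ ↦ FiniteDimensional K N)
      (fun m ↦ ?_) (fun N₁ N₂ _ _ h₁ h₂ ↦ ?_) ⊤ Module.Finite.fg_top
    · obtain ⟨⟨r, hr⟩, s, hs⟩ := htors m
      exact finiteDimensional_span_singleton hβ hσ hr hs
    · have h₁' : FiniteDimensional K (N₁.restrictScalars K) := h₁
      have h₂' : FiniteDimensional K (N₂.restrictScalars K) := h₂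
      have := Submodule.finiteDimensional_sup (N₁.restrictScalars K) (N₂.restrictScalars K)
      rw [← Submodule.restrictScalars_sup] at this
      exact this
  exact Module.Finite.equiv ((Submodule.topEquiv (R := DownUp K α β γ) (M := M)).restrictScalars K)

end Torsion

section TorsionModule

open Polynomial

variable {K : Type} [Field K] {α β γ : K}

/-- The operator `(v₀, …, vₙ₋₁) ↦ (p₁v₁, …, pₙ₋₁vₙ₋₁, 0)`. -/
def weightedShiftDown {K : Type} [Field K] (p : ℕ → K[X]) (n : ℕ) :
    Module.End K (Fin n → K[X]) where
  toFun v i := if h : i.1 + 1 < n then p (i + 1) * v ⟨i + 1, h⟩ else 0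
  map_add' v w := by
    ext1 i
    by_cases h : i.1 + 1 < n <;> simp [h, mul_add]
  map_smul' c v := by
    ext1 i
    by_cases h : i.1 + 1 < n <;> simp [h]

/-- The operator `(v₀, …, vₙ₋₁) ↦ (0, v₀, …, vₙ₋₂)`. -/
def shiftUp (K : Type) [Field K] (n : ℕ) : Module.End K (Fin n → K[X]) where
  toFun v i := if i.1 = 0 then 0 else v ⟨i - 1, by omega⟩
  map_add' v w := by
    ext1 i
    by_cases h : i.1 = 0 <;> simp [h]
  map_smul' c v := by
    ext1 i
    by_cases h : i.1 = 0 <;> simp [h]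

theorem weightedShiftDown_apply (p : ℕ → K[X]) (n : ℕ) (v : Fin n → K[X]) (i : Fin n) :
    weightedShiftDown p n v i = if h : i.1 + 1 < n then p (i + 1) * v ⟨i + 1, h⟩ else 0 :=
  rfl

theorem shiftUp_apply (n : ℕ) (v : Fin n → K[X]) (i : Fin n) :
    shiftUp K n v i = if i.1 = 0 then 0 else v ⟨i - 1, by omega⟩ :=
  rfl

theorem weightedShiftDown_shiftUp (p : ℕ → K[X]) {n : ℕ} (hn : p n = 0) (v : Fin n → K[X])
    (i : Fin n) : weightedShiftDown p n (shiftUp K n v) i = p (i + 1) * v i := by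
  rw [weightedShiftDown_apply]
  split_ifs with h
  · simp [shiftUp_apply]
  · have : i.1 + 1 = n := by omega
    rw [this, hn, zero_mul]

theorem shiftUp_weightedShiftDown (p : ℕ → K[X]) {n : ℕ} (h0 : p 0 = 0) (v : Fin n → K[X])
    (i : Fin n) : shiftUp K n (weightedShiftDown p n v) i = p i * v i := by
  rw [shiftUp_apply]
  split_ifs with h
  · rw [h, h0, zero_mul]
  · have h1 : i.1 - 1 + 1 = i.1 := by omega
    simp [weightedShiftDown_apply, h1]

theorem weightedShiftDown_pow_apply (p : ℕ → K[X]) (n k : ℕ) (v : Fin n → K[X]) (i : Fin n)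
    (hi : n ≤ i + k) : (weightedShiftDown p n ^ k) v i = 0 := by
  induction k generalizing i with
  | zero => omega
  | succ k ih =>
    rw [pow_succ', Module.End.mul_apply, weightedShiftDown_apply]
    split_ifs with h
    · rw [ih ⟨i + 1, h⟩ (by simp only; omega), mul_zero]
    · rfl

theorem shiftUp_pow_apply (n k : ℕ) (v : Fin n → K[X]) (i : Fin n) :
    (shiftUp K n ^ k) v i = if i.1 < k then 0 else v ⟨i - k, by omega⟩ := by
  induction k generalizing i with
  | zero => simp
  | succ k ih =>
    rw [pow_succ', Module.End.mul_apply, shiftUp_apply]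
    split_ifs with h h' h'
    · rfl
    · omega
    · rw [ih, if_pos (by simp only; omega)]
    · rw [ih, if_neg (by simp only; omega)]
      congr 2
      simp only
      omega

/-- The action of the down-up algebra on `K[X]ⁿ` by weighted shifts. -/
def shiftRep (p : ℕ → K[X]) {n : ℕ} (h0 : p 0 = 0) (hn : p n = 0)
    (hp : ∀ i, p (i + 2) = C α * p (i + 1) + C β * p i + C γ) :
    DownUp K α β γ →ₐ[K] Module.End K (Fin n → K[X]) :=
  RingQuot.liftAlgHom K ⟨FreeAlgebra.lift K ![weightedShiftDown p n, shiftUp K n], by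
    rintro _ _ (_ | _)
    · refine LinearMap.ext fun v ↦ funext fun i ↦ ?_
      simp only [map_mul, map_add, map_smul, FreeAlgebra.lift_ι_apply, Matrix.cons_val_zero,
        Matrix.cons_val_one, Module.End.mul_apply, LinearMap.add_apply, LinearMap.smul_apply,
        Pi.add_apply, Pi.smul_apply, shiftUp_weightedShiftDown p h0,
        weightedShiftDown_shiftUp p hn]
      rw [weightedShiftDown_apply, weightedShiftDown_apply]
      split_ifs with h
      · rw [weightedShiftDown_shiftUp p hn, hp]
        simp only [smul_eq_C_mul]
        ring
      · simp
    · refine LinearMap.ext fun v ↦ funext fun i ↦ ?_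
      simp only [map_mul, map_add, map_smul, FreeAlgebra.lift_ι_apply, Matrix.cons_val_zero,
        Matrix.cons_val_one, Module.End.mul_apply, LinearMap.add_apply, LinearMap.smul_apply,
        Pi.add_apply, Pi.smul_apply, weightedShiftDown_shiftUp p hn]
      rw [shiftUp_apply, shiftUp_apply, shiftUp_apply]
      split_ifs with h
      · simp
      · obtain ⟨⟨_ | j, hj⟩⟩ := i
        · exact absurd rfl h
        · simp only [Nat.add_sub_cancel, weightedShiftDown_shiftUp p hn,
            shiftUp_weightedShiftDown p h0, hp, smul_eq_C_mul]
          ring⟩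

theorem shiftRep_d (p : ℕ → K[X]) {n : ℕ} (h0 : p 0 = 0) (hn : p n = 0)
    (hp : ∀ i, p (i + 2) = C α * p (i + 1) + C β * p i + C γ) :
    shiftRep p h0 hn hp (DownUp.d K α β γ) = weightedShiftDown p n := by
  simp [shiftRep, DownUp.d]

theorem shiftRep_u (p : ℕ → K[X]) {n : ℕ} (h0 : p 0 = 0) (hn : p n = 0)
    (hp : ∀ i, p (i + 2) = C α * p (i + 1) + C β * p i + C γ) :
    shiftRep p h0 hn hp (DownUp.u K α β γ) = shiftUp K n := by
  simp [shiftRep, DownUp.u]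

/-- A periodicity `σ^n(x) ∈ (x)` yields a cyclic torsion module of infinite dimension. -/
theorem exists_infinite_torsion_module {n : ℕ} (hpos : 1 ≤ n)
    (hn : (duSigma K α β γ ^ n) (MvPolynomial.X 0) ∈
      Ideal.span ({MvPolynomial.X 0} : Set (MvPolynomial (Fin 2) K))) :
    ∃ (M : Type) (_ : AddCommGroup M) (_ : Module K M)
      (_ : Module (DownUp K α β γ) M) (_ : IsScalarTower K (DownUp K α β γ) M),
      Module.Finite (DownUp K α β γ) M ∧
      (∀ m : M, (∃ r : ℕ, (DownUp.d K α β γ) ^ r • m = 0) ∧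
        (∃ s : ℕ, (DownUp.u K α β γ) ^ s • m = 0)) ∧
      ¬ FiniteDimensional K M := by
  let p (i : ℕ) : K[X] := restrictLine K ((duSigma K α β γ ^ i) (MvPolynomial.X 0))
  have h0 : p 0 = 0 := by simp [p, restrictLine]
  have h1 : p 1 = X := by simp [p, restrictLine, duSigma]
  have hpn : p n = 0 := restrictLine_eq_zero_of_mem hn
  have hp (i : ℕ) : p (i + 2) = C α * p (i + 1) + C β * p i + C γ := by
    have hx : duSigma K α β γ (MvPolynomial.X 0) = MvPolynomial.X 1 := by simp [duSigma]
    have hy : duSigma K α β γ (MvPolynomial.X 1) = MvPolynomial.C α * MvPolynomial.X 1 +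
      MvPolynomial.C β * MvPolynomial.X 0 + MvPolynomial.C γ := by simp [duSigma]
    simp only [p, pow_succ, AlgHom.mul_apply, hx, hy, map_add, map_mul, MvPolynomial.algHom_C,
      ← Polynomial.algebraMap_eq]
    simp [← MvPolynomial.algebraMap_eq]
  let ρ := shiftRep p h0 hpn hp
  let _ : Module (DownUp K α β γ) (Fin n → K[X]) := Module.compHom _ ρ.toRingHom
  have smul_def (a : DownUp K α β γ) (v : Fin n → K[X]) : a • v = ρ a v := rfl
  have tower : IsScalarTower K (DownUp K α β γ) (Fin n → K[X]) :=
    ⟨fun c a v ↦ by simp [smul_def]⟩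
  have hdn : weightedShiftDown p n ^ n = 0 :=
    LinearMap.ext fun v ↦ funext fun i ↦ weightedShiftDown_pow_apply p n n v i (by omega)
  have hun : shiftUp K n ^ n = 0 :=
    LinearMap.ext fun v ↦ funext fun i ↦ by simp [shiftUp_pow_apply]
  refine ⟨Fin n → K[X], inferInstance, inferInstance, inferInstance, tower, ?_,
    fun m ↦ ⟨⟨n, ?_⟩, n, ?_⟩, fun hfin ↦ ?_⟩
  · let e : Fin n → K[X] := Pi.single ⟨0, hpos⟩ 1
    let N : Submodule (DownUp K α β γ) (Fin n → K[X]) := Submodule.span _ {e}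
    have hbase (q : K[X]) : (Pi.single ⟨0, hpos⟩ q : Fin n → K[X]) ∈ N := by
      induction q using Polynomial.induction_on with
      | C a =>
        have : (Pi.single ⟨0, hpos⟩ (C a) : Fin n → K[X]) = a • e := by
          simp [e, ← Pi.single_smul, smul_eq_C_mul]
        rw [this]
        exact N.smul_of_tower_mem a (Submodule.mem_span_singleton_self e)
      | add q₁ q₂ h₁ h₂ =>
        rw [Pi.single_add]
        exact N.add_mem h₁ h₂
      | monomial k a h =>
        have : (Pi.single ⟨0, hpos⟩ (C a * X ^ (k + 1)) : Fin n → K[X]) =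
            (DownUp.d K α β γ * DownUp.u K α β γ) •
              (Pi.single ⟨0, hpos⟩ (C a * X ^ k) : Fin n → K[X]) := by
          funext i
          rw [smul_def, map_mul, shiftRep_d, shiftRep_u, Module.End.mul_apply,
            weightedShiftDown_shiftUp p hpn]
          rcases eq_or_ne i ⟨0, hpos⟩ with rfl | hi
          · simp only [Pi.single_eq_same, zero_add, h1]
            ring
          · simp [hi]
        rw [this]
        exact N.smul_mem _ h
    have hsingle (i : Fin n) (q : K[X]) : (Pi.single i q : Fin n → K[X]) ∈ N := by
      have : (Pi.single i q : Fin n → K[X]) =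
          DownUp.u K α β γ ^ i.1 • (Pi.single ⟨0, hpos⟩ q : Fin n → K[X]) := by
        funext j
        rw [smul_def, map_pow, shiftRep_u, shiftUp_pow_apply, Pi.single_apply, Pi.single_apply]
        simp only [Fin.ext_iff]
        split_ifs <;> first | rfl | omega
      rw [this]
      exact N.smul_mem _ (hbase q)
    refine ⟨⟨{e}, ?_⟩⟩
    rw [Finset.coe_singleton, eq_top_iff]
    intro v _
    rw [← Finset.univ_sum_single v]
    exact N.sum_mem fun i _ ↦ hsingle i (v i)
  · rw [smul_def, map_pow, shiftRep_d, hdn, LinearMap.zero_apply]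
  · rw [smul_def, map_pow, shiftRep_u, hun, LinearMap.zero_apply]
  · have : FiniteDimensional K K[X] :=
      Module.Finite.of_surjective (LinearMap.proj (R := K) (φ := fun _ : Fin n ↦ K[X]) ⟨0, hpos⟩)
        (Function.surjective_eval _)
    exact Polynomial.not_finite this

end TorsionModule

open MvPolynomial in
/-- for `β ≠ 0`, every finitely generated left `A(α,β,γ)`-module
which is both `d`-torsion and `u`-torsion is finite-dimensional over `K` if and
only if `σ^n(x) ∉ (x)` for all `n ≥ 1`. -/
theorem downUp_torsion_fd_iff_sigma_orbit (K : Type) [Field K] [IsAlgClosed K]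
    (α β γ : K) (hβ : β ≠ 0) :
    (∀ (M : Type) (_ : AddCommGroup M) (_ : Module K M)
        (_ : Module (DownUp K α β γ) M) (_ : IsScalarTower K (DownUp K α β γ) M),
        Module.Finite (DownUp K α β γ) M →
        (∀ m : M, (∃ r : ℕ, (DownUp.d K α β γ) ^ r • m = 0) ∧
            (∃ s : ℕ, (DownUp.u K α β γ) ^ s • m = 0)) →
        FiniteDimensional K M) ↔
    (∀ n : ℕ, 1 ≤ n →
        ((duSigma K α β γ) ^ n) (X 0) ∉ Ideal.span ({X 0} : Set (MvPolynomial (Fin 2) K))) := by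
  constructor
  · intro h n hpos hn
    obtain ⟨M, i₁, i₂, i₃, i₄, hfin, htors, hinf⟩ := exists_infinite_torsion_module hpos hn
    exact hinf (h M i₁ i₂ i₃ i₄ hfin htors)
  · intro hσ M _ _ _ _ _ htors
    exact finiteDimensional_of_torsion hβ hσ htors
end
end

section
/- Let K be an algebraically closed field and α, β, γ ∈ K with β ≠ 0. Then: (i) there is a K-algebra isomorphism from A(α,β,γ) to A(−α·β^{-1}, β^{-1}, −γ·β^{-1}) which sends the generator d of the first algebra to the generator u' of the second and sends u to d'; and (ii) if γ ≠ 0, then A(α,β,γ) is isomorphic as a K-algebra to A(α,β,1). -/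
noncomputable section

namespace DownUp

variable {K : Type} [Field K] {α β γ : K}

theorem d_mul_d_mul_u_s8 : d K α β γ * d K α β γ * u K α β γ =
    α • (d K α β γ * u K α β γ * d K α β γ) + β • (u K α β γ * d K α β γ * d K α β γ) +
      γ • d K α β γ := by
  simpa [d, u] using RingQuot.mkAlgHom_rel K (DownUpRel.rel1 (K := K) (α := α) (β := β) (γ := γ))

theorem d_mul_u_mul_u_s8 : d K α β γ * u K α β γ * u K α β γ =
    α • (u K α β γ * d K α β γ * u K α β γ) + β • (u K α β γ * u K α β γ * d K α β γ) +
      γ • u K α β γ := by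
  simpa [d, u] using RingQuot.mkAlgHom_rel K (DownUpRel.rel2 (K := K) (α := α) (β := β) (γ := γ))

/-- The universal property of the down-up algebra. -/
def lift {B : Type*} [Ring B] [Algebra K B] (x y : B)
    (h₁ : x * x * y = α • (x * y * x) + β • (y * x * x) + γ • x)
    (h₂ : x * y * y = α • (y * x * y) + β • (y * y * x) + γ • y) :
    DownUp K α β γ →ₐ[K] B :=
  RingQuot.liftAlgHom K ⟨FreeAlgebra.lift K ![x, y], fun _ _ h => by
    cases h with
    | rel1 => simpa using h₁
    | rel2 => simpa using h₂⟩

section lift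

variable {B : Type*} [Ring B] [Algebra K B] {x y : B}
  (h₁ : x * x * y = α • (x * y * x) + β • (y * x * x) + γ • x)
  (h₂ : x * y * y = α • (y * x * y) + β • (y * y * x) + γ • y)

@[simp]
theorem lift_d : lift x y h₁ h₂ (d K α β γ) = x := by
  simp [lift, d]

@[simp]
theorem lift_u : lift x y h₁ h₂ (u K α β γ) = y := by
  simp [lift, u]

end lift

theorem algHom_ext {B : Type*} [Ring B] [Algebra K B] {f g : DownUp K α β γ →ₐ[K] B}
    (hd : f (d K α β γ) = g (d K α β γ)) (hu : f (u K α β γ) = g (u K α β γ)) : f = g := by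
  apply RingQuot.ringQuot_ext'
  apply FreeAlgebra.hom_ext
  funext i
  fin_cases i
  · exact hd
  · exact hu

/-- Solving `x = a • p + b • y + c • q` for `y`. -/
theorem eq_smul_add_iff {B : Type*} [Ring B] [Algebra K B] {a b c : K} (hb : b ≠ 0)
    {x y p q : B} :
    y = (-a * b⁻¹) • p + b⁻¹ • x + (-c * b⁻¹) • q ↔ x = a • p + b • y + c • q := by
  constructor
  · rintro rfl
    match_scalars <;> field_simp <;> ring
  · rintro rfl
    match_scalars <;> field_simp <;> ring

/-- The isomorphism interchanging the two generators. -/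
def swapEquiv (hβ : β ≠ 0) :
    DownUp K α β γ ≃ₐ[K] DownUp K (-α * β⁻¹) β⁻¹ (-γ * β⁻¹) :=
  AlgEquiv.ofAlgHom
    (lift (u K _ _ _) (d K _ _ _)
      (by rw [← eq_smul_add_iff hβ]; exact d_mul_u_mul_u_s8)
      (by rw [← eq_smul_add_iff hβ]; exact d_mul_d_mul_u_s8))
    (lift (u K _ _ _) (d K _ _ _)
      (by rw [eq_smul_add_iff hβ]; exact d_mul_u_mul_u_s8)
      (by rw [eq_smul_add_iff hβ]; exact d_mul_d_mul_u_s8))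
    (algHom_ext (by simp) (by simp))
    (algHom_ext (by simp) (by simp))

/-- Multiplying `d` by a nonzero scalar `c` rescales the parameter `γ` by `c`. -/
def rescaleEquiv (α β γ : K) {c : K} (hc : c ≠ 0) :
    DownUp K α β (c * γ) ≃ₐ[K] DownUp K α β γ :=
  AlgEquiv.ofAlgHom
    (lift (c • d K α β γ) (u K α β γ)
      (by
        simp only [smul_mul_assoc, mul_smul_comm, d_mul_d_mul_u_s8]
        module)
      (by
        simp only [smul_mul_assoc, mul_smul_comm, d_mul_u_mul_u_s8]
        module))
    (lift (c⁻¹ • d K α β (c * γ)) (u K α β (c * γ))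
      (by
        simp only [smul_mul_assoc, mul_smul_comm, d_mul_d_mul_u_s8]
        match_scalars <;> field_simp)
      (by
        simp only [smul_mul_assoc, mul_smul_comm, d_mul_u_mul_u_s8]
        match_scalars <;> field_simp))
    (algHom_ext (by simp [smul_smul, hc]) (by simp))
    (algHom_ext (by simp [smul_smul, hc]) (by simp))

end DownUp

/-- i: `A(α,β,γ) ≅ A(−αβ⁻¹, β⁻¹, −γβ⁻¹)` via the map
interchanging `d` and `u`; (ii): if `γ ≠ 0` then `A(α,β,γ) ≅ A(α,β,1)`. -/
theorem downUp_iso_swap_and_rescale (K : Type) [Field K] [IsAlgClosed K]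
    (α β γ : K) (hβ : β ≠ 0) :
    (∃ e : DownUp K α β γ ≃ₐ[K] DownUp K (-α * β⁻¹) β⁻¹ (-γ * β⁻¹),
        e (DownUp.d K α β γ) = DownUp.u K (-α * β⁻¹) β⁻¹ (-γ * β⁻¹) ∧
        e (DownUp.u K α β γ) = DownUp.d K (-α * β⁻¹) β⁻¹ (-γ * β⁻¹)) ∧
    (γ ≠ 0 → Nonempty (DownUp K α β γ ≃ₐ[K] DownUp K α β 1)) := by
  refine ⟨⟨DownUp.swapEquiv hβ, ?_, ?_⟩, fun hγ => ?_⟩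
  · simp [DownUp.swapEquiv]
  · simp [DownUp.swapEquiv]
  · have e := DownUp.rescaleEquiv α β 1 hγ
    rw [mul_one] at e
    exact ⟨e⟩
end
end
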